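/- Assume condition (C) and fix β ∈ (0,1). Then there exist γ₀ < 0 and a stationary Markov policy u : E → U such that for every γ ∈ [γ₀,0] and every x ∈ E, J_γ(x,u;β) = sup_{π∈Π} J_γ(x,π;β); likewise there exist γ₀' > 0 and a stationary Markov policy u' : E → U such that for every γ ∈ [0,γ₀'] and every x ∈ E, J_γ(x,u';β) = sup_{π∈Π} J_γ(x,π;β). -/

import Mathlib

open Filter Real

/-- A (history-dependent) policy: at time `n`, the action is a function of `(X_0, …, X_n)`. -/
abbrev Policy (E U : Type*) : Type _ := ∀ n : ℕ, (Fin (n + 1) → E) → U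

/-- The stationary Markov policy induced by `u : E → U`. -/
def stationaryPolicy {E U : Type*} (u : E → U) : Policy E U :=
  fun n h => u (h (Fin.last n))

/-- The Markov policy induced by a sequence `u : ℕ → E → U`. -/
def markovPolicy {E U : Type*} (u : ℕ → E → U) : Policy E U :=
  fun n h => u n (h (Fin.last n))

/-- The action taken at time `i` by policy `pol` along the path `ω = (x_0, …, x_n)`. -/
def act {E U : Type*} (pol : Policy E U) {n : ℕ} (ω : Fin (n + 1) → E) (i : Fin n) : U :=
  pol i.1 (fun j => ω (Fin.castLE (Nat.succ_le_succ i.2.le) j))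

/-- Probability of the path `ω = (x_0, …, x_n)` under policy `pol` started at `x`:
`∏_{i=0}^{n-1} P^{a_i}(x_i, x_{i+1})` if `x_0 = x`, and `0` otherwise. -/
def pathProb {E U : Type*} [DecidableEq E] (P : U → E → E → ℝ) (pol : Policy E U)
    (x : E) (n : ℕ) (ω : Fin (n + 1) → E) : ℝ :=
  (if ω 0 = x then 1 else 0) * ∏ i : Fin n, P (act pol ω i) (ω i.castSucc) (ω i.succ)

/-- Expectation `E_x^pol[f(X_0, …, X_n)]`. -/
noncomputable def expVal {E U : Type*} [Fintype E] [DecidableEq E]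
    (P : U → E → E → ℝ) (pol : Policy E U) (x : E) (n : ℕ)
    (f : (Fin (n + 1) → E) → ℝ) : ℝ :=
  ∑ ω : Fin (n + 1) → E, pathProb P pol x n ω * f ω

/-- The (possibly discounted) cumulative reward `Σ_{i=0}^{n-1} d i * c(X_i, a_i)` along `ω`. -/
def rewSum {E U : Type*} (c : E → U → ℝ) (pol : Policy E U) (d : ℕ → ℝ) (n : ℕ)
    (ω : Fin (n + 1) → E) : ℝ :=
  ∑ i : Fin n, d i.1 * c (ω i.castSucc) (act pol ω i)

/-- Long-run risk-sensitive averaged criterion `J_γ(x, pol)`. -/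
noncomputable def Javg {E U : Type*} [Fintype E] [DecidableEq E]
    (P : U → E → E → ℝ) (c : E → U → ℝ) (γ : ℝ) (x : E) (pol : Policy E U) : ℝ :=
  if γ = 0 then
    liminf (fun n : ℕ =>
      (1 / (n : ℝ)) * expVal P pol x n (rewSum c pol (fun _ => 1) n)) atTop
  else
    liminf (fun n : ℕ =>
      (1 / ((n : ℝ) * γ)) * Real.log (expVal P pol x n
        (fun ω => Real.exp (γ * rewSum c pol (fun _ => 1) n ω)))) atTop

/-- Discounted risk-sensitive criterion `J_γ(x, pol; β)`. -/
noncomputable def Jdisc {E U : Type*} [Fintype E] [DecidableEq E]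
    (P : U → E → E → ℝ) (c : E → U → ℝ) (γ : ℝ) (x : E) (pol : Policy E U) (β : ℝ) : ℝ :=
  if γ = 0 then
    limUnder atTop (fun n : ℕ => expVal P pol x n (rewSum c pol (fun i => β ^ i) n))
  else
    (1 / γ) * Real.log (limUnder atTop (fun n : ℕ =>
      expVal P pol x n (fun ω => Real.exp (γ * rewSum c pol (fun i => β ^ i) n ω))))

/-- Row-stochasticity of the family of transition matrices `(P^a)_{a ∈ U}`. -/
def IsStochastic {E U : Type*} [Fintype E] (P : U → E → E → ℝ) : Prop :=
  (∀ a x y, 0 ≤ P a x y) ∧ ∀ a x, ∑ y, P a x y = 1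

/-- Condition (C): strong uniform mixing, `min_{a} min_{x,y} P^a(x,y) > 0`. -/
def CondC {E U : Type*} (P : U → E → E → ℝ) : Prop :=
  ∀ a x y, 0 < P a x y

/-- `w` solves the risk-sensitive discounted Bellman equation for discount `β`. -/
def IsBellmanSol {E U : Type*} [Fintype E] [Fintype U]
    (P : U → E → E → ℝ) (c : E → U → ℝ) (β : ℝ) (w : E → ℝ → ℝ) : Prop :=
  ∀ x : E, ∀ γ : ℝ, γ ≠ 0 →
    w x γ = ⨆ a : U, (c x a + (1 / γ) * Real.log (∑ y, Real.exp (w y (β * γ)) * P a x y))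

section PathRecursion

variable {E U : Type*}

lemma act_snoc_castSucc (pol : Policy E U) {n : ℕ} (ω : Fin (n + 1) → E) (y : E) (i : Fin n) :
    act pol (Fin.snoc (α := fun _ => E) ω y) i.castSucc = act pol ω i := by
  unfold act
  congr 1
  funext j
  have : (Fin.castLE (Nat.succ_le_succ i.castSucc.2.le) j : Fin (n + 1 + 1))
      = Fin.castSucc (Fin.castLE (Nat.succ_le_succ i.2.le) j) := by
    ext; rfl
  rw [this, Fin.snoc_castSucc]

lemma act_snoc_last (pol : Policy E U) {n : ℕ} (ω : Fin (n + 1) → E) (y : E) :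
    act pol (Fin.snoc (α := fun _ => E) ω y) (Fin.last n) = pol n ω := by
  unfold act
  change pol n _ = _
  congr 1
  funext j
  have : (Fin.castLE (Nat.succ_le_succ (Fin.last n).2.le) j : Fin (n + 1 + 1))
      = Fin.castSucc j := by
    ext; rfl
  rw [this, Fin.snoc_castSucc]

lemma rewSum_snoc (c : E → U → ℝ) (pol : Policy E U) (d : ℕ → ℝ) (n : ℕ)
    (ω : Fin (n + 1) → E) (y : E) :
    rewSum c pol d (n + 1) (Fin.snoc (α := fun _ => E) ω y)
      = rewSum c pol d n ω + d n * c (ω (Fin.last n)) (pol n ω) := by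
  unfold rewSum
  rw [Fin.sum_univ_castSucc]
  simp only [act_snoc_castSucc, act_snoc_last, Fin.snoc_castSucc, Fin.val_castSucc, Fin.val_last]

lemma pathProb_snoc [DecidableEq E] (P : U → E → E → ℝ) (pol : Policy E U) (x : E) (n : ℕ)
    (ω : Fin (n + 1) → E) (y : E) :
    pathProb P pol x (n + 1) (Fin.snoc (α := fun _ => E) ω y)
      = pathProb P pol x n ω * P (pol n ω) (ω (Fin.last n)) y := by
  unfold pathProb
  rw [Fin.prod_univ_castSucc]
  have h0 : Fin.snoc (α := fun _ => E) ω y 0 = ω 0 := by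
    rw [← Fin.castSucc_zero, Fin.snoc_castSucc]
  simp only [act_snoc_castSucc, act_snoc_last, Fin.snoc_castSucc, ← Fin.castSucc_succ, h0,
    Fin.succ_last, Fin.snoc_last]
  ring

variable [Fintype E] [DecidableEq E]

lemma expVal_succ (P : U → E → E → ℝ) (pol : Policy E U) (x : E) (n : ℕ)
    (f : (Fin (n + 1 + 1) → E) → ℝ) :
    expVal P pol x (n + 1) f = expVal P pol x n (fun ω =>
      ∑ y, P (pol n ω) (ω (Fin.last n)) y * f (Fin.snoc (α := fun _ => E) ω y)) := by
  unfold expVal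
  rw [← (Fin.snocEquiv (fun _ : Fin (n + 1 + 1) => E)).sum_comp, Fintype.sum_prod_type,
    Finset.sum_comm]
  refine Finset.sum_congr rfl fun ω _ => ?_
  rw [Finset.mul_sum]
  refine Finset.sum_congr rfl fun y _ => ?_
  have : (Fin.snocEquiv (fun _ : Fin (n + 1 + 1) => E)) (y, ω)
      = Fin.snoc (α := fun _ => E) ω y := rfl
  rw [this, pathProb_snoc]
  ring

lemma expVal_zero (P : U → E → E → ℝ) (pol : Policy E U) (x : E) (f : (Fin 1 → E) → ℝ) :
    expVal P pol x 0 f = f (fun _ => x) := by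
  unfold expVal pathProb
  rw [Finset.sum_eq_single (fun _ => x)]
  · simp
  · intro ω _ hω
    have : ω 0 ≠ x := fun h => hω (by funext i; rw [Fin.fin_one_eq_zero i, h])
    simp [this]
  · simp

lemma expVal_const_mul (P : U → E → E → ℝ) (pol : Policy E U) (x : E) (n : ℕ) (a : ℝ)
    (f : (Fin (n + 1) → E) → ℝ) :
    expVal P pol x n (fun ω => a * f ω) = a * expVal P pol x n f := by
  unfold expVal
  rw [Finset.mul_sum]
  exact Finset.sum_congr rfl fun ω _ => by ring

lemma expVal_sub (P : U → E → E → ℝ) (pol : Policy E U) (x : E) (n : ℕ)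
    (f g : (Fin (n + 1) → E) → ℝ) :
    expVal P pol x n (fun ω => f ω - g ω) = expVal P pol x n f - expVal P pol x n g := by
  unfold expVal
  rw [← Finset.sum_sub_distrib]
  exact Finset.sum_congr rfl fun ω _ => by ring

variable {P : U → E → E → ℝ}

lemma IsStochastic.pathProb_nonneg (hP : IsStochastic P) (pol : Policy E U) (x : E) (n : ℕ)
    (ω : Fin (n + 1) → E) : 0 ≤ pathProb P pol x n ω :=
  mul_nonneg (by split_ifs <;> simp) (Finset.prod_nonneg fun _ _ => hP.1 _ _ _)

lemma IsStochastic.expVal_mono (hP : IsStochastic P) (pol : Policy E U) (x : E) (n : ℕ)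
    {f g : (Fin (n + 1) → E) → ℝ} (h : ∀ ω, f ω ≤ g ω) :
    expVal P pol x n f ≤ expVal P pol x n g :=
  Finset.sum_le_sum fun ω _ => mul_le_mul_of_nonneg_left (h ω) (hP.pathProb_nonneg pol x n ω)

lemma IsStochastic.expVal_succ_init (hP : IsStochastic P) (pol : Policy E U) (x : E) (n : ℕ)
    (f : (Fin (n + 1) → E) → ℝ) :
    expVal P pol x (n + 1) (fun ω => f (Fin.init (α := fun _ => E) ω)) = expVal P pol x n f := by
  rw [expVal_succ]
  congr 1
  funext ω
  simp only [Fin.init_snoc, ← Finset.sum_mul, hP.2, one_mul]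

lemma IsStochastic.expVal_const (hP : IsStochastic P) (pol : Policy E U) (x : E) (n : ℕ) (a : ℝ) :
    expVal P pol x n (fun _ => a) = a := by
  induction n with
  | zero => rw [expVal_zero]
  | succ n ih => exact (hP.expVal_succ_init pol x n (fun _ => a)).trans ih

lemma IsStochastic.abs_expVal_le (hP : IsStochastic P) (pol : Policy E U) (x : E) (n : ℕ)
    {f : (Fin (n + 1) → E) → ℝ} {K : ℝ} (h : ∀ ω, |f ω| ≤ K) : |expVal P pol x n f| ≤ K := by
  rw [abs_le, ← hP.expVal_const pol x n (-K), ← hP.expVal_const pol x n K]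
  constructor
  · rw [hP.expVal_const pol x n K]
    exact hP.expVal_mono pol x n fun ω => (abs_le.1 (h ω)).1
  · exact hP.expVal_mono pol x n fun ω => (abs_le.1 (h ω)).2

end PathRecursion

section Convergence

variable {E U : Type*} {c : E → U → ℝ} {β C : ℝ}

lemma abs_rewSum_le (hβ : β ∈ Set.Ioo (0 : ℝ) 1) (hc : ∀ x a, |c x a| ≤ C) (pol : Policy E U)
    (n : ℕ) (ω : Fin (n + 1) → E) : |rewSum c pol (fun i => β ^ i) n ω| ≤ C / (1 - β) := by
  have hC : 0 ≤ C := (abs_nonneg _).trans (hc (ω 0) (pol 0 fun _ => ω 0))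
  calc |rewSum c pol (fun i => β ^ i) n ω|
      ≤ ∑ i : Fin n, |β ^ (i : ℕ) * c (ω i.castSucc) (act pol ω i)| :=
        Finset.abs_sum_le_sum_abs _ _
    _ ≤ ∑ i : Fin n, β ^ (i : ℕ) * C := by
        refine Finset.sum_le_sum fun i _ => ?_
        rw [abs_mul, abs_of_nonneg (pow_nonneg hβ.1.le _)]
        exact mul_le_mul_of_nonneg_left (hc _ _) (pow_nonneg hβ.1.le _)
    _ = (∑ i ∈ Finset.range n, β ^ i) * C := by
        rw [← Finset.sum_mul, Fin.sum_univ_eq_sum_range (fun i => β ^ i)]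
    _ ≤ (1 - β)⁻¹ * C := by
        refine mul_le_mul_of_nonneg_right ?_ hC
        rw [← tsum_geometric_of_lt_one hβ.1.le hβ.2]
        exact (summable_geometric_of_lt_one hβ.1.le hβ.2).sum_le_tsum _
          fun i _ => pow_nonneg hβ.1.le _
    _ = C / (1 - β) := by rw [div_eq_mul_inv, mul_comm]

variable [Fintype E] [DecidableEq E] {P : U → E → E → ℝ}

lemma exists_tendsto_expVal (hP : IsStochastic P) (hβ : β ∈ Set.Ioo (0 : ℝ) 1)
    (hc : ∀ x a, |c x a| ≤ C) (pol : Policy E U) (x : E) {g : ℝ → ℝ} {K : ℝ} (hK : 0 ≤ K)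
    (hg : ∀ a b, |a| ≤ C / (1 - β) → |b| ≤ C / (1 - β) → |g a - g b| ≤ K * |a - b|) :
    ∃ F, Tendsto (fun n => expVal P pol x n
      (fun ω => g (rewSum c pol (fun i => β ^ i) n ω))) atTop (nhds F) := by
  refine cauchySeq_tendsto_of_complete (cauchySeq_of_le_geometric β (K * C) hβ.2 fun n => ?_)
  rw [dist_comm, Real.dist_eq, expVal_succ, ← expVal_sub]
  refine hP.abs_expVal_le pol x n fun ω => ?_
  simp only [rewSum_snoc, ← Finset.sum_mul, hP.2, one_mul]
  have hb := abs_rewSum_le hβ hc pol (n + 1)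
    (Fin.snoc (α := fun _ => E) ω (ω 0))
  rw [rewSum_snoc] at hb
  refine (hg _ _ hb (abs_rewSum_le hβ hc pol n ω)).trans ?_
  rw [add_sub_cancel_left, abs_mul, abs_of_nonneg (pow_nonneg hβ.1.le _), mul_assoc, mul_comm C]
  exact mul_le_mul_of_nonneg_left
    (mul_le_mul_of_nonneg_left (hc _ _) (pow_nonneg hβ.1.le _)) hK

lemma exists_tendsto_expVal_rewSum (hP : IsStochastic P) (hβ : β ∈ Set.Ioo (0 : ℝ) 1)
    (hc : ∀ x a, |c x a| ≤ C) (pol : Policy E U) (x : E) :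
    ∃ F, Tendsto (fun n => expVal P pol x n (rewSum c pol (fun i => β ^ i) n)) atTop (nhds F) :=
  exists_tendsto_expVal hP hβ hc pol x (g := id) zero_le_one fun a b _ _ => by simp

lemma exists_tendsto_expVal_exp (hP : IsStochastic P) (hβ : β ∈ Set.Ioo (0 : ℝ) 1)
    (hc : ∀ x a, |c x a| ≤ C) (pol : Policy E U) (x : E) (γ : ℝ) :
    ∃ F, Tendsto (fun n => expVal P pol x n
      (fun ω => Real.exp (γ * rewSum c pol (fun i => β ^ i) n ω))) atTop (nhds F) := by
  set B := C / (1 - β)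
  refine exists_tendsto_expVal hP hβ hc pol x (g := fun r => Real.exp (γ * r))
    (K := Real.exp (|γ| * B) * |γ|) (by positivity) fun a b ha hb => ?_
  have := (convex_Icc (-B) B).norm_image_sub_le_of_norm_hasDerivWithin_le
    (f := fun r => Real.exp (γ * r)) (f' := fun r => Real.exp (γ * r) * γ)
    (C := Real.exp (|γ| * B) * |γ|) (x := b) (y := a)
    (fun r _ => by
      have h := ((hasDerivAt_id r).const_mul γ).exp
      simp only [id, mul_one] at h
      exact h.hasDerivWithinAt)
    (fun r hr => by
      rw [Real.norm_eq_abs, abs_mul, Real.abs_exp]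
      refine mul_le_mul_of_nonneg_right (Real.exp_le_exp.2 ((le_abs_self _).trans ?_))
        (abs_nonneg _)
      rw [abs_mul]
      exact mul_le_mul_of_nonneg_left (abs_le.2 hr) (abs_nonneg _))
    (abs_le.1 hb) (abs_le.1 ha)
  simpa [Real.norm_eq_abs] using this

lemma limit_expVal_exp_pos (hP : IsStochastic P) (hβ : β ∈ Set.Ioo (0 : ℝ) 1)
    (hc : ∀ x a, |c x a| ≤ C) {pol : Policy E U} {x : E} {γ F : ℝ}
    (hF : Tendsto (fun n => expVal P pol x n
      (fun ω => Real.exp (γ * rewSum c pol (fun i => β ^ i) n ω))) atTop (nhds F)) : 0 < F := by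
  refine (Real.exp_pos (-(|γ| * (C / (1 - β))))).trans_le (ge_of_tendsto' hF fun n => ?_)
  rw [← hP.expVal_const pol x n (Real.exp (-(|γ| * (C / (1 - β)))))]
  refine hP.expVal_mono pol x n fun ω => Real.exp_le_exp.2 ?_
  refine (neg_le_neg ?_).trans (neg_abs_le _)
  rw [abs_mul]
  exact mul_le_mul_of_nonneg_left (abs_rewSum_le hβ hc pol n ω) (abs_nonneg _)

lemma abs_limit_expVal_exp_sub_le (hP : IsStochastic P) (hβ : β ∈ Set.Ioo (0 : ℝ) 1)
    (hc : ∀ x a, |c x a| ≤ C) {pol : Policy E U} {x : E} {γ F M : ℝ}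
    (hγ : |γ| * (C / (1 - β)) ≤ 1)
    (hF : Tendsto (fun n => expVal P pol x n
      (fun ω => Real.exp (γ * rewSum c pol (fun i => β ^ i) n ω))) atTop (nhds F))
    (hM : Tendsto (fun n => expVal P pol x n (rewSum c pol (fun i => β ^ i) n)) atTop (nhds M)) :
    |F - 1 - γ * M| ≤ (|γ| * (C / (1 - β))) ^ 2 := by
  refine le_of_tendsto' ((hF.sub_const 1).sub (hM.const_mul γ)).abs fun n => ?_
  have key : expVal P pol x n (fun ω => Real.exp (γ * rewSum c pol (fun i => β ^ i) n ω)) - 1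
      - γ * expVal P pol x n (rewSum c pol (fun i => β ^ i) n)
      = expVal P pol x n (fun ω => Real.exp (γ * rewSum c pol (fun i => β ^ i) n ω) - 1
        - γ * rewSum c pol (fun i => β ^ i) n ω) := by
    rw [expVal_sub, expVal_sub, hP.expVal_const, expVal_const_mul]
  rw [key]
  refine hP.abs_expVal_le pol x n fun ω => ?_
  have hb : |γ * rewSum c pol (fun i => β ^ i) n ω| ≤ |γ| * (C / (1 - β)) := by
    rw [abs_mul]
    exact mul_le_mul_of_nonneg_left (abs_rewSum_le hβ hc pol n ω) (abs_nonneg _)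
  refine (Real.abs_exp_sub_one_sub_id_le (hb.trans hγ)).trans ?_
  rw [← sq_abs]
  exact pow_le_pow_left₀ (abs_nonneg _) hb 2

/-- Verification: a function which is `s`-subinvariant for the one-step multiplicative operators
along `pol` is dominated, up to the sign `s`, by the exponential functional of `pol`. -/
lemma le_limit_expVal_exp (hP : IsStochastic P) (hβ : β ∈ Set.Ioo (0 : ℝ) 1)
    (hc : ∀ x a, |c x a| ≤ C) {pol : Policy E U} {x : E} {s γ F : ℝ} {V : E → ℝ → ℝ}
    (hV : ∀ y, ContinuousAt (V y) 0) (hV0 : ∀ y, V y 0 = 1)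
    (hsub : ∀ n (h : Fin (n + 1) → E), s * V (h (Fin.last n)) (β ^ n * γ) ≤
      s * (Real.exp (β ^ n * γ * c (h (Fin.last n)) (pol n h)) *
        ∑ y, P (pol n h) (h (Fin.last n)) y * V y (β * (β ^ n * γ))))
    (hF : Tendsto (fun n => expVal P pol x n
      (fun ω => Real.exp (γ * rewSum c pol (fun i => β ^ i) n ω))) atTop (nhds F)) :
    s * V x γ ≤ s * F := by
  set R : (n : ℕ) → (Fin (n + 1) → E) → ℝ := fun n => rewSum c pol (fun i => β ^ i) n with hR
  set G : ℕ → ℝ := fun n => expVal P pol x n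
    (fun ω => s * (Real.exp (γ * R n ω) * V (ω (Fin.last n)) (β ^ n * γ))) with hG
  have hmono : Monotone G := by
    refine monotone_nat_of_le_succ fun n => ?_
    simp only [hG]
    rw [expVal_succ]
    refine hP.expVal_mono pol x n fun ω => ?_
    have h := mul_le_mul_of_nonneg_left (hsub n ω) (Real.exp_pos (γ * R n ω)).le
    calc s * (Real.exp (γ * R n ω) * V (ω (Fin.last n)) (β ^ n * γ))
        = Real.exp (γ * R n ω) * (s * V (ω (Fin.last n)) (β ^ n * γ)) := by ring
      _ ≤ _ := h
      _ = _ := by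
        simp only [hR, rewSum_snoc, Fin.snoc_last]
        rw [Finset.mul_sum, Finset.mul_sum, Finset.mul_sum]
        refine Finset.sum_congr rfl fun y _ => ?_
        rw [mul_add, Real.exp_add, pow_succ]
        ring_nf
  have hG0 : G 0 = s * V x γ := by
    simp only [hG, hR]
    rw [expVal_zero]
    simp [rewSum]
  have hlim : Tendsto G atTop (nhds (s * F)) := by
    have hpow : Tendsto (fun n : ℕ => β ^ n * γ) atTop (nhds 0) := by
      simpa using (tendsto_pow_atTop_nhds_zero_of_lt_one hβ.1.le hβ.2).mul_const γ
    have hsum : Tendsto (fun n : ℕ => |s| * (Real.exp (|γ| * (C / (1 - β)))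
        * ∑ y, |V y (β ^ n * γ) - 1|)) atTop (nhds 0) := by
      have : Tendsto (fun n : ℕ => ∑ y, |V y (β ^ n * γ) - 1|) atTop (nhds 0) := by
        have h : ∀ y ∈ Finset.univ, Tendsto (fun n : ℕ => |V y (β ^ n * γ) - 1|) atTop
            (nhds 0) := fun y _ => by
          have := (((hV y).tendsto.comp hpow).sub_const 1).abs
          simpa [hV0] using this
        simpa using tendsto_finsetSum Finset.univ h
      simpa using (this.const_mul (Real.exp (|γ| * (C / (1 - β))))).const_mul |s|
    have hdiff : Tendsto (fun n => G n - s * expVal P pol x n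
        (fun ω => Real.exp (γ * R n ω))) atTop (nhds 0) := by
      refine squeeze_zero_norm (fun n => ?_) hsum
      simp only [hG]
      rw [Real.norm_eq_abs, ← expVal_const_mul, ← expVal_sub]
      refine hP.abs_expVal_le pol x n fun ω => ?_
      rw [← mul_sub, ← mul_sub_one, abs_mul, abs_mul, Real.abs_exp]
      have hb : γ * R n ω ≤ |γ| * (C / (1 - β)) := by
        refine (le_abs_self _).trans ?_
        rw [abs_mul]
        exact mul_le_mul_of_nonneg_left (abs_rewSum_le hβ hc pol n ω) (abs_nonneg _)
      refine mul_le_mul_of_nonneg_left (mul_le_mul (Real.exp_le_exp.2 hb) ?_ (abs_nonneg _)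
        (Real.exp_pos _).le) (abs_nonneg _)
      exact Finset.single_le_sum (f := fun y => |V y (β ^ n * γ) - 1|)
        (fun y _ => abs_nonneg _) (Finset.mem_univ _)
    refine (zero_add (s * F) ▸ hdiff.add (hF.const_mul s)).congr fun n => ?_
    simp only [hR, sub_add_cancel]
  rw [← hG0]
  exact hmono.ge_of_tendsto hlim 0

end Convergence

section StationaryValue

variable {E U : Type*} [Fintype E]

/-- The `n`-step exponential functional of a stationary policy, with complex risk parameter. -/
noncomputable def stationaryIterate (P : U → E → E → ℝ) (c : E → U → ℝ) (β : ℝ) (u : E → U) :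
    ℕ → E → ℂ → ℂ
  | 0, _, _ => 1
  | n + 1, x, z => Complex.exp (z * (c x (u x) : ℂ)) *
      ∑ y, (P (u x) x y : ℂ) * stationaryIterate P c β u n y (β * z)

variable {P : U → E → E → ℝ} {c : E → U → ℝ} {β C : ℝ}

lemma differentiable_stationaryIterate (u : E → U) (n : ℕ) (x : E) :
    Differentiable ℂ (stationaryIterate P c β u n x) := by
  induction n generalizing x with
  | zero => exact differentiable_const _
  | succ n ih =>
    have h : ∀ y, Differentiable ℂ fun z : ℂ => stationaryIterate P c β u n y (β * z) :=
      fun y => (ih y).comp (differentiable_id.const_mul (β : ℂ))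
    simp only [stationaryIterate]
    fun_prop

lemma stationaryIterate_zero_right (hP : IsStochastic P) (u : E → U) (n : ℕ) (x : E) :
    stationaryIterate P c β u n x 0 = 1 := by
  induction n generalizing x with
  | zero => rfl
  | succ n ih =>
    simp only [stationaryIterate, mul_zero, ih, mul_one, zero_mul, Complex.exp_zero, one_mul]
    exact_mod_cast hP.2 (u x) x

lemma IsStochastic.norm_sum_le (hP : IsStochastic P) (a : U) (x : E) {f : E → ℂ} {K : ℝ}
    (hf : ∀ y, ‖f y‖ ≤ K) : ‖∑ y, (P a x y : ℂ) * f y‖ ≤ K := by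
  calc ‖∑ y, (P a x y : ℂ) * f y‖ ≤ ∑ y, ‖(P a x y : ℂ) * f y‖ := _root_.norm_sum_le _ _
    _ ≤ ∑ y, P a x y * K := by
        refine Finset.sum_le_sum fun y _ => ?_
        rw [norm_mul, Complex.norm_real, Real.norm_of_nonneg (hP.1 a x y)]
        exact mul_le_mul_of_nonneg_left (hf y) (hP.1 a x y)
    _ = K := by rw [← Finset.sum_mul, hP.2, one_mul]

lemma norm_stationaryIterate_succ_sub_le (hP : IsStochastic P) (hβ : β ∈ Set.Ioo (0 : ℝ) 1)
    (hc : ∀ x a, |c x a| ≤ C) (u : E → U) (n : ℕ) (x : E) (z : ℂ) :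
    ‖stationaryIterate P c β u (n + 1) x z - stationaryIterate P c β u n x z‖
      ≤ ‖z‖ * C * Real.exp (‖z‖ * (C / (1 - β))) * β ^ n := by
  have hC : 0 ≤ C := (abs_nonneg _).trans (hc x (u x))
  have hβ' : 0 < 1 - β := sub_pos.2 hβ.2
  have hzc : ‖z * (c x (u x) : ℂ)‖ ≤ ‖z‖ * C := by
    rw [norm_mul, Complex.norm_real, Real.norm_eq_abs]
    exact mul_le_mul_of_nonneg_left (hc _ _) (norm_nonneg _)
  induction n generalizing x z with
  | zero =>
    have hsum : ∑ y, (P (u x) x y : ℂ) = 1 := by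
      exact_mod_cast hP.2 (u x) x
    simp only [stationaryIterate, mul_one, hsum, pow_zero]
    have h := Complex.norm_exp_sub_sum_le_norm_mul_exp (z * (c x (u x) : ℂ)) 1
    simp only [Finset.range_one, Finset.sum_singleton, pow_zero, Nat.factorial_zero, Nat.cast_one,
      div_one, pow_one] at h
    refine h.trans (mul_le_mul hzc (Real.exp_le_exp.2 (hzc.trans ?_)) (Real.exp_pos _).le
      (by positivity))
    refine mul_le_mul_of_nonneg_left ?_ (norm_nonneg _)
    rw [le_div_iff₀ hβ']
    nlinarith [hβ.1]
  | succ n ih =>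
    rw [stationaryIterate, stationaryIterate, ← mul_sub, ← Finset.sum_sub_distrib]
    simp only [← mul_sub]
    rw [norm_mul]
    have h1 : ‖Complex.exp (z * (c x (u x) : ℂ))‖ ≤ Real.exp (‖z‖ * C) :=
      (Complex.norm_exp_le_exp_norm _).trans (Real.exp_le_exp.2 hzc)
    have hz : ‖(β : ℂ) * z‖ = β * ‖z‖ := by
      rw [norm_mul, Complex.norm_real, Real.norm_of_nonneg hβ.1.le]
    have h2 := hP.norm_sum_le (u x) x (f := fun y => stationaryIterate P c β u (n + 1) y (β * z)
      - stationaryIterate P c β u n y (β * z)) (fun y => ih y (β * z) (by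
        rw [norm_mul, Complex.norm_real, Real.norm_eq_abs]
        exact mul_le_mul_of_nonneg_left (hc _ _) (norm_nonneg _)))
    rw [hz] at h2
    refine (mul_le_mul h1 h2 (norm_nonneg _) (Real.exp_pos _).le).trans_eq ?_
    have : ‖z‖ * (C / (1 - β)) = ‖z‖ * C + β * ‖z‖ * (C / (1 - β)) := by
      field_simp
      ring
    rw [this, Real.exp_add]
    ring

lemma exists_entire_stationary_value (hP : IsStochastic P) (hβ : β ∈ Set.Ioo (0 : ℝ) 1)
    (hc : ∀ x a, |c x a| ≤ C) (u : E → U) :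
    ∃ L : E → ℂ → ℂ, (∀ x, Differentiable ℂ (L x)) ∧ (∀ x, L x 0 = 1) ∧
      ∀ x z, L x z = Complex.exp (z * (c x (u x) : ℂ)) * ∑ y, (P (u x) x y : ℂ) * L y (β * z) := by
  set W := stationaryIterate P c β u with hW
  have hdist : ∀ x z n, dist (W n x z) (W (n + 1) x z)
      ≤ ‖z‖ * C * Real.exp (‖z‖ * (C / (1 - β))) * β ^ n := fun x z n => by
    rw [dist_comm, dist_eq_norm]
    exact norm_stationaryIterate_succ_sub_le hP hβ hc u n x z
  choose L hL using fun x z =>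
    cauchySeq_tendsto_of_complete (cauchySeq_of_le_geometric β _ hβ.2 (hdist x z))
  have hβ' : 0 < 1 - β := sub_pos.2 hβ.2
  refine ⟨L, fun x => ?_, fun x => ?_, fun x z => ?_⟩
  · have hC : 0 ≤ C := (abs_nonneg _).trans (hc x (u x))
    intro z₀
    set r := ‖z₀‖ + 1
    have hunif : TendstoUniformlyOn (fun n => W n x) (L x) atTop (Metric.ball 0 r) := by
      rw [Metric.tendstoUniformlyOn_iff]
      intro ε hε
      have hlim : Tendsto (fun n : ℕ => r * C * Real.exp (r * (C / (1 - β))) * β ^ n / (1 - β))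
          atTop (nhds 0) := by
        simpa using ((tendsto_pow_atTop_nhds_zero_of_lt_one hβ.1.le hβ.2).const_mul
          (r * C * Real.exp (r * (C / (1 - β))))).div_const (1 - β)
      filter_upwards [hlim.eventually (gt_mem_nhds hε)] with n hn z hz
      rw [dist_comm]
      refine ((dist_le_of_le_geometric_of_tendsto β _ hβ.2 (hdist x z) (hL x z) n).trans ?_).trans_lt
        hn
      have hz' : ‖z‖ ≤ r := (mem_ball_zero_iff.1 hz).le
      have hr : 0 ≤ r := (norm_nonneg z).trans hz'
      have := hβ.1
      gcongr
    have hd := hunif.tendstoLocallyUniformlyOn.differentiableOn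
      (Eventually.of_forall fun n => (differentiable_stationaryIterate u n x).differentiableOn)
      Metric.isOpen_ball
    exact hd.differentiableAt (Metric.isOpen_ball.mem_nhds (by simp [r]))
  · refine tendsto_nhds_unique (hL x 0) ?_
    simp only [hW, stationaryIterate_zero_right hP]
    exact tendsto_const_nhds
  · refine tendsto_nhds_unique ((hL x z).comp (tendsto_add_atTop_nat 1)) ?_
    exact (tendsto_finsetSum Finset.univ fun y _ => (hL y (β * z)).const_mul _).const_mul _

lemma exists_analytic_stationary_value (hP : IsStochastic P) (hβ : β ∈ Set.Ioo (0 : ℝ) 1)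
    (hc : ∀ x a, |c x a| ≤ C) (u : E → U) :
    ∃ L : E → ℝ → ℝ, (∀ x t, AnalyticAt ℝ (L x) t) ∧ (∀ x, L x 0 = 1) ∧
      ∀ x t, L x t = Real.exp (t * c x (u x)) * ∑ y, P (u x) x y * L y (β * t) := by
  obtain ⟨L, hd, h0, hrec⟩ := exists_entire_stationary_value hP hβ hc u
  refine ⟨fun x t => (L x t).re, fun x t => ((hd x).analyticAt _).re_ofReal, fun x => by simp [h0],
    fun x t => ?_⟩
  simp only
  rw [hrec]
  norm_cast
  rw [Complex.re_ofReal_mul, Complex.re_sum]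
  simp only [Complex.re_ofReal_mul]

end StationaryValue

section Optimality

lemma eventually_sign_eq_near_zero {f : ℝ → ℝ} (hf : AnalyticAt ℝ f 0) (hcont : Continuous f) :
    ∀ᶠ t₀ in nhdsWithin (0 : ℝ) (Set.Ioi 0), ∀ t ∈ Set.Ioc 0 t₀, 0 < f t ↔ 0 < f t₀ := by
  rcases hf.eventually_eq_zero_or_eventually_ne_zero with h | h
  · obtain ⟨ε, hε, hball⟩ := Metric.eventually_nhds_iff.1 h
    have hzero : ∀ r, 0 < r → r < ε → f r = 0 := fun r hr hrε => hball (by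
      rwa [Real.dist_eq, sub_zero, abs_of_pos hr])
    filter_upwards [Ioo_mem_nhdsGT hε] with t₀ ht₀ t ht
    rw [hzero t ht.1 (ht.2.trans_lt ht₀.2), hzero t₀ ht₀.1 ht₀.2]
  · obtain ⟨ε, hε, hball⟩ := Metric.eventually_nhds_iff.1 (eventually_nhdsWithin_iff.1 h)
    filter_upwards [Ioo_mem_nhdsGT hε] with t₀ ht₀ t ht
    have hne : ∀ r ∈ Set.Icc t t₀, f r ≠ 0 := fun r hr => by
      have hr_pos : 0 < r := ht.1.trans_le hr.1
      refine hball (y := r) ?_ hr_pos.ne'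
      rw [Real.dist_eq, sub_zero, abs_of_pos hr_pos]
      exact hr.2.trans_lt ht₀.2
    constructor <;> intro hpos <;> by_contra hneg
    · obtain ⟨r, hr, hr0⟩ := intermediate_value_Icc' ht.2 hcont.continuousOn
        ⟨not_lt.1 hneg, hpos.le⟩
      exact hne r hr hr0
    · obtain ⟨r, hr, hr0⟩ := intermediate_value_Icc ht.2 hcont.continuousOn
        ⟨not_lt.1 hneg, hpos.le⟩
      exact hne r hr hr0

variable {E U : Type*} [Fintype E] [DecidableEq E] {P : U → E → E → ℝ} {c : E → U → ℝ} {β C : ℝ}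

lemma tendsto_expVal_exp_stationary (hP : IsStochastic P) (hβ : β ∈ Set.Ioo (0 : ℝ) 1)
    (hc : ∀ x a, |c x a| ≤ C) {u : E → U} {L : E → ℝ → ℝ} (hL : ∀ x, ContinuousAt (L x) 0)
    (hL0 : ∀ x, L x 0 = 1)
    (hrec : ∀ x t, L x t = Real.exp (t * c x (u x)) * ∑ y, P (u x) x y * L y (β * t))
    (x : E) (γ : ℝ) :
    Tendsto (fun n => expVal P (stationaryPolicy u) x n
      (fun ω => Real.exp (γ * rewSum c (stationaryPolicy u) (fun i => β ^ i) n ω)))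
      atTop (nhds (L x γ)) := by
  obtain ⟨F, hF⟩ := exists_tendsto_expVal_exp hP hβ hc (stationaryPolicy u) x γ
  have h1 := le_limit_expVal_exp (s := 1) hP hβ hc hL hL0
    (fun n h => (congrArg (1 * ·) (hrec (h (Fin.last n)) (β ^ n * γ))).le) hF
  have h2 := le_limit_expVal_exp (s := -1) hP hβ hc hL hL0
    (fun n h => (congrArg (-1 * ·) (hrec (h (Fin.last n)) (β ^ n * γ))).le) hF
  have : F = L x γ := by linarith
  exact this ▸ hF

/-- On a one-sided neighbourhood of zero some stationary policy has a value which no one-step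
deviation improves. -/
lemma exists_unimprovable_stationary [Fintype U] [Nonempty U] (hP : IsStochastic P)
    (hβ : β ∈ Set.Ioo (0 : ℝ) 1) (hc : ∀ x a, |c x a| ≤ C) (s : ℝ) :
    ∃ t₀ : ℝ, 0 < t₀ ∧ ∃ (u : E → U) (L : E → ℝ → ℝ), (∀ x, ContinuousAt (L x) 0) ∧
      (∀ x, L x 0 = 1) ∧
      (∀ x t, L x t = Real.exp (t * c x (u x)) * ∑ y, P (u x) x y * L y (β * t)) ∧
      ∀ t ∈ Set.Ioc 0 t₀, ∀ x a,
        s * (Real.exp (s * t * c x a) * ∑ y, P a x y * L y (β * (s * t))) ≤ s * L x (s * t) := by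
  choose L hLa hL0 hrec using fun u : E → U => exists_analytic_stationary_value hP hβ hc u
  have hLc : ∀ u x, Continuous (L u x) := fun u x =>
    continuous_iff_continuousAt.2 fun t => (hLa u x t).continuousAt
  set f : (E → U) → E → U → ℝ → ℝ := fun u x a t =>
    s * (Real.exp (s * t * c x a) * ∑ y, P a x y * L u y (β * (s * t))) - s * L u x (s * t) with hf
  have hfa : ∀ u x a, AnalyticAt ℝ (f u x a) 0 := fun u x a => by
    have h1 : ∀ y, AnalyticAt ℝ (fun t : ℝ => L u y (β * (s * t))) 0 := fun y =>
      (hLa u y _).comp (g := L u y) (f := fun t : ℝ => β * (s * t)) (by fun_prop)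
    have h2 : AnalyticAt ℝ (fun t : ℝ => L u x (s * t)) 0 :=
      (hLa u x _).comp (g := L u x) (f := fun t : ℝ => s * t) (by fun_prop)
    have h3 : AnalyticAt ℝ (fun t : ℝ => ∑ y, P a x y * L u y (β * (s * t))) 0 :=
      Finset.analyticAt_fun_sum _ fun y _ => analyticAt_const.mul (h1 y)
    have h4 : AnalyticAt ℝ (fun t : ℝ => Real.exp (s * t * c x a)) 0 := by fun_prop
    exact (analyticAt_const.mul (h4.mul h3)).sub (analyticAt_const.mul h2)
  have hfc : ∀ u x a, Continuous (f u x a) := fun u x a => by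
    simp only [hf]
    fun_prop
  obtain ⟨t₀, hsign, ht₀⟩ := ((eventually_all.2 fun u => eventually_all.2 fun x =>
    eventually_all.2 fun a => eventually_sign_eq_near_zero (hfa u x a) (hfc u x a)).and
    (self_mem_nhdsWithin (a := (0 : ℝ)) (s := Set.Ioi 0))).exists
  have ht₀' : (0 : ℝ) < t₀ := ht₀
  obtain ⟨u, hu⟩ := Finite.exists_max fun u : E → U => ∑ x, s * L u x (s * t₀)
  refine ⟨t₀, ht₀', u, L u, fun x => (hLc u x).continuousAt, hL0 u, hrec u,
    fun t ht x a => not_lt.1 fun hlt => ?_⟩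
  set u' := Function.update u x a with hu'
  have hpos : ∀ r ∈ Set.Ioc 0 t₀, 0 < f u x a r := fun r hr =>
    (hsign u x a r hr).2 ((hsign u x a t ht).1 (sub_pos.2 hlt))
  have hsub : ∀ r ∈ Set.Ioc 0 t₀, ∀ y, s * L u y (s * r) ≤
      s * (Real.exp (s * r * c y (u' y)) * ∑ z, P (u' y) y z * L u z (β * (s * r))) := by
    intro r hr y
    by_cases hy : y = x
    · subst hy
      rw [hu', Function.update_self]
      exact (sub_pos.1 (hpos r hr)).le
    · rw [hu', Function.update_of_ne hy]
      exact (congrArg (s * ·) (hrec u y (s * r))).le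
  have himp : ∀ r ∈ Set.Ioc 0 t₀, ∀ y, s * L u y (s * r) ≤ s * L u' y (s * r) := fun r hr y => by
    refine le_limit_expVal_exp hP hβ hc (fun y => (hLc u y).continuousAt) (hL0 u) (fun n h => ?_)
      (tendsto_expVal_exp_stationary hP hβ hc (fun y => (hLc u' y).continuousAt) (hL0 u') (hrec u')
        y (s * r))
    have hn : β ^ n * r ∈ Set.Ioc 0 t₀ := ⟨mul_pos (pow_pos hβ.1 n) hr.1,
      (mul_le_of_le_one_left hr.1.le (pow_le_one₀ hβ.1.le hβ.2.le)).trans hr.2⟩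
    rw [mul_left_comm]
    exact hsub _ hn _
  refine (hu u').not_gt (Finset.sum_lt_sum (fun y _ => himp t₀ ⟨ht₀', le_rfl⟩ y)
    ⟨x, Finset.mem_univ x, ?_⟩)
  refine (sub_pos.1 (hpos t₀ ⟨ht₀', le_rfl⟩)).trans_le ?_
  rw [hrec u' x, hu', Function.update_self, ← hu', mul_left_comm s, mul_left_comm s]
  refine mul_le_mul_of_nonneg_left ?_ (Real.exp_pos _).le
  rw [Finset.mul_sum, Finset.mul_sum]
  refine Finset.sum_le_sum fun y _ => ?_
  rw [mul_left_comm s, mul_left_comm s, mul_left_comm β]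
  exact mul_le_mul_of_nonneg_left (himp (β * t₀) ⟨mul_pos hβ.1 ht₀',
    mul_le_of_le_one_left ht₀'.le hβ.2.le⟩ y) (hP.1 _ _ _)

lemma Jdisc_zero_eq {pol : Policy E U} {x : E} {M : ℝ}
    (hM : Tendsto (fun n => expVal P pol x n (rewSum c pol (fun i => β ^ i) n)) atTop (nhds M)) :
    Jdisc P c 0 x pol β = M := by
  rw [Jdisc, if_pos rfl, hM.limUnder_eq]

lemma Jdisc_eq_log {pol : Policy E U} {x : E} {γ F : ℝ} (hγ : γ ≠ 0)
    (hF : Tendsto (fun n => expVal P pol x n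
      (fun ω => Real.exp (γ * rewSum c pol (fun i => β ^ i) n ω))) atTop (nhds F)) :
    Jdisc P c γ x pol β = (1 / γ) * Real.log F := by
  rw [Jdisc, if_neg hγ, hF.limUnder_eq]

lemma exists_stationary_optimal_one_sided [Fintype U] [Nonempty U] (hP : IsStochastic P)
    (hβ : β ∈ Set.Ioo (0 : ℝ) 1) {s : ℝ} (hs : s = 1 ∨ s = -1) :
    ∃ t₀ : ℝ, 0 < t₀ ∧ ∃ u : E → U, ∀ t ∈ Set.Icc 0 t₀, ∀ (x : E) (pol : Policy E U),
      Jdisc P c (s * t) x pol β ≤ Jdisc P c (s * t) x (stationaryPolicy u) β := by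
  obtain ⟨C, hC⟩ := Finite.exists_le fun p : E × U => |c p.1 p.2|
  have hc : ∀ x a, |c x a| ≤ C := fun x a => hC (x, a)
  obtain ⟨t₀, ht₀, u, L, hL, hL0, hrec, hopt⟩ := exists_unimprovable_stationary hP hβ hc s
  have hlimu := tendsto_expVal_exp_stationary hP hβ hc hL hL0 hrec
  have hss : s * s = 1 := by rcases hs with rfl | rfl <;> norm_num
  have hs0 : s ≠ 0 := by rintro rfl; simp at hss
  have hdom : ∀ t ∈ Set.Ioc 0 t₀, ∀ (x : E) (pol : Policy E U) (F : ℝ),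
      Tendsto (fun n => expVal P pol x n
        (fun ω => Real.exp (s * t * rewSum c pol (fun i => β ^ i) n ω))) atTop (nhds F) →
      s * F ≤ s * L x (s * t) := by
    intro t ht x pol F hF
    have := le_limit_expVal_exp (s := -s) hP hβ hc hL hL0 (fun n h => ?_) hF
    · linarith
    · have hn : β ^ n * t ∈ Set.Ioc 0 t₀ := ⟨mul_pos (pow_pos hβ.1 n) ht.1,
        (mul_le_of_le_one_left ht.1.le (pow_le_one₀ hβ.1.le hβ.2.le)).trans ht.2⟩
      rw [mul_left_comm, neg_mul, neg_mul]
      exact neg_le_neg (hopt _ hn _ _)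
  refine ⟨t₀, ht₀, u, fun t ht x pol => ?_⟩
  rcases ht.1.eq_or_lt with rfl | htpos
  · obtain ⟨M, hM⟩ := exists_tendsto_expVal_rewSum hP hβ hc pol x
    obtain ⟨M', hM'⟩ := exists_tendsto_expVal_rewSum hP hβ hc (stationaryPolicy u) x
    rw [mul_zero, Jdisc_zero_eq hM, Jdisc_zero_eq hM']
    set B := C / (1 - β)
    have hlim : Tendsto (fun t : ℝ => M' + 2 * B ^ 2 * t) (nhdsWithin 0 (Set.Ioi 0)) (nhds M') := by
      have : Tendsto (fun t : ℝ => M' + 2 * B ^ 2 * t) (nhds 0) (nhds (M' + 2 * B ^ 2 * 0)) :=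
        (Continuous.tendsto (by fun_prop) 0)
      rw [mul_zero, add_zero] at this
      exact this.mono_left nhdsWithin_le_nhds
    have hsmall : ∀ᶠ t : ℝ in nhdsWithin 0 (Set.Ioi 0), t * B ≤ 1 := by
      have : Tendsto (fun t : ℝ => t * B) (nhds 0) (nhds (0 * B)) :=
        (Continuous.tendsto (by fun_prop) 0)
      rw [zero_mul] at this
      exact nhdsWithin_le_nhds (this.eventually (ge_mem_nhds one_pos))
    refine ge_of_tendsto hlim ?_
    filter_upwards [hsmall, Ioc_mem_nhdsGT ht₀] with t htB ht
    obtain ⟨F, hF⟩ := exists_tendsto_expVal_exp hP hβ hc pol x (s * t)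
    have habs : |s * t| = t := by
      rcases hs with rfl | rfl <;> simp [abs_of_pos ht.1]
    have h1 := abs_limit_expVal_exp_sub_le hP hβ hc (by rwa [habs]) hF hM
    have h2 := abs_limit_expVal_exp_sub_le hP hβ hc (by rwa [habs]) (hlimu x (s * t)) hM'
    have h3 := hdom t ht x pol F hF
    rw [habs, mul_pow] at h1 h2
    rw [abs_le] at h1 h2
    have h4 : t * M ≤ t * (M' + 2 * B ^ 2 * t) := by
      rcases hs with rfl | rfl <;> nlinarith [h1.1, h1.2, h2.1, h2.2]
    exact le_of_mul_le_mul_left h4 ht.1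
  · obtain ⟨F, hF⟩ := exists_tendsto_expVal_exp hP hβ hc pol x (s * t)
    have hne : s * t ≠ 0 := mul_ne_zero hs0 htpos.ne'
    rw [Jdisc_eq_log hne hF, Jdisc_eq_log hne (hlimu x (s * t))]
    have hFpos := limit_expVal_exp_pos hP hβ hc hF
    have hLpos := limit_expVal_exp_pos hP hβ hc (hlimu x (s * t))
    have h := hdom t ⟨htpos, ht.2⟩ x pol F hF
    rcases hs with rfl | rfl
    · refine mul_le_mul_of_nonneg_left (Real.log_le_log hFpos (by linarith)) ?_
      rw [one_mul]
      positivity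
    · refine mul_le_mul_of_nonpos_left (Real.log_le_log hLpos (by linarith)) ?_
      rw [neg_one_mul, one_div_nonpos]
      linarith

end Optimality

/-- Jaquette: under condition (C) and for fixed `β ∈ (0,1)`, there is a
`γ₀ < 0` and a stationary Markov policy which is `β`-discount optimal for every
`γ ∈ [γ₀, 0]`; likewise there is `γ₀' > 0` and a stationary Markov policy which is
`β`-discount optimal for every `γ ∈ [0, γ₀']`. -/
theorem ultimate_stationarity_near_zero
    {E U : Type*} [Fintype E] [DecidableEq E] [Fintype U] [Nonempty E] [Nonempty U]
    (P : U → E → E → ℝ) (c : E → U → ℝ) (β : ℝ)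
    (hP : IsStochastic P) (hC : CondC P) (hβ : β ∈ Set.Ioo (0 : ℝ) 1) :
    (∃ γ₀ : ℝ, γ₀ < 0 ∧ ∃ u : E → U, ∀ γ ∈ Set.Icc γ₀ (0 : ℝ), ∀ x : E,
      Jdisc P c γ x (stationaryPolicy u) β = ⨆ pol : Policy E U, Jdisc P c γ x pol β) ∧
    (∃ γ₀' : ℝ, 0 < γ₀' ∧ ∃ u' : E → U, ∀ γ ∈ Set.Icc (0 : ℝ) γ₀', ∀ x : E,
      Jdisc P c γ x (stationaryPolicy u') β = ⨆ pol : Policy E U, Jdisc P c γ x pol β) := by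
  have hsup : ∀ (γ : ℝ) (x : E) (u : E → U),
      (∀ pol : Policy E U, Jdisc P c γ x pol β ≤ Jdisc P c γ x (stationaryPolicy u) β) →
      Jdisc P c γ x (stationaryPolicy u) β = ⨆ pol : Policy E U, Jdisc P c γ x pol β :=
    fun γ x u h => le_antisymm
      (le_ciSup (f := fun pol : Policy E U => Jdisc P c γ x pol β)
        ⟨_, Set.forall_mem_range.2 h⟩ (stationaryPolicy u))
      (ciSup_le h)
  obtain ⟨t₀, ht₀, u, hu⟩ :=
    exists_stationary_optimal_one_sided (c := c) hP hβ (s := -1) (Or.inr rfl)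
  obtain ⟨t₁, ht₁, v, hv⟩ :=
    exists_stationary_optimal_one_sided (c := c) hP hβ (s := 1) (Or.inl rfl)
  refine ⟨⟨-t₀, neg_neg_of_pos ht₀, u, fun γ hγ x => hsup γ x u fun pol => ?_⟩,
    ⟨t₁, ht₁, v, fun γ hγ x => hsup γ x v fun pol => ?_⟩⟩
  · have := hu (-γ) ⟨by linarith [hγ.2], by linarith [hγ.1]⟩ x pol
    rwa [neg_one_mul, neg_neg] at this
  · have := hv γ hγ x pol
    rwa [one_mul] at this
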